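/- arXiv:2207.13990 — 4 statements merged into one kernel-verified Lean document; each statement's English description precedes it below -/
import Mathlib

section
/- For an infinite compact Hausdorff space K, the space C(K) has the ℓ1-Grothendieck property if and only if it has the Δ-Grothendieck property; that is, every weak* convergent sequence of countably supported signed Radon measures on K is weakly convergent if and only if every weak* convergent sequence of finitely supported signed Radon measures on K is weakly convergent. -/
open MeasureTheory Filter Topology Set
open scoped ENNReal

namespace JNP

variable {K : Type*} [TopologicalSpace K] [MeasurableSpace K] [BorelSpace K]

/-- The total variation norm of a signed Borel measure. -/
noncomputable def tvNorm (μ : SignedMeasure K) : ℝ :=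
  (μ.totalVariation Set.univ).toReal

/-- A signed Borel measure is Radon if its total variation is a regular measure. -/
def IsRadon (μ : SignedMeasure K) : Prop :=
  μ.totalVariation.Regular

/-- The integral of a function against a signed measure. -/
noncomputable def integ (μ : SignedMeasure K) (f : K → ℝ) : ℝ :=
  ∫ x, f x ∂μ.toJordanDecomposition.posPart -
    ∫ x, f x ∂μ.toJordanDecomposition.negPart

/-- The support of a signed measure: the set of points all of whose open
neighbourhoods have nonzero total variation. -/
def msupport (μ : SignedMeasure K) : Set K :=
  {x : K | ∀ U : Set K, IsOpen U → x ∈ U → μ.totalVariation U ≠ 0}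

/-- Weak* convergence of a sequence of signed measures: convergence of the integrals of
every continuous real-valued function. -/
def WeakStarTendsto (μs : ℕ → SignedMeasure K) (μ : SignedMeasure K) : Prop :=
  ∀ f : C(K, ℝ), Tendsto (fun n => integ (μs n) f) atTop (𝓝 (integ μ f))

/-- A sequence of signed measures is weak* null if the integral of every continuous
real-valued function tends to `0`. -/
def WeakStarNull (μs : ℕ → SignedMeasure K) : Prop :=
  ∀ f : C(K, ℝ), Tendsto (fun n => integ (μs n) f) atTop (𝓝 (0 : ℝ))

/-- Weak convergence of a sequence of signed measures: convergence under every bounded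
linear functional on the Banach space of signed measures with the total variation norm
(which, for Radon measures, is `C(K)*` by the Riesz representation theorem). -/
def WeakTendsto (μs : ℕ → SignedMeasure K) (μ : SignedMeasure K) : Prop :=
  ∀ φ : SignedMeasure K →ₗ[ℝ] ℝ,
    (∃ C : ℝ, ∀ ν : SignedMeasure K, |φ ν| ≤ C * tvNorm ν) →
    Tendsto (fun n => φ (μs n)) atTop (𝓝 (φ μ))

variable (K) in
/-- The Grothendieck property: every weak* convergent sequence of signed Radon measures
is weakly convergent. -/
def GrothendieckProp : Prop :=
  ∀ (μs : ℕ → SignedMeasure K) (μ : SignedMeasure K),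
    (∀ n, IsRadon (μs n)) → IsRadon μ → WeakStarTendsto μs μ → WeakTendsto μs μ

variable (K) in
/-- The ℓ₁-Grothendieck property: every weak* convergent sequence of countably supported
signed Radon measures is weakly convergent. -/
def Ell1Grothendieck : Prop :=
  ∀ (μs : ℕ → SignedMeasure K) (μ : SignedMeasure K),
    (∀ n, IsRadon (μs n)) → (∀ n, (msupport (μs n)).Countable) →
    IsRadon μ → WeakStarTendsto μs μ → WeakTendsto μs μ

variable (K) in
/-- The Δ-Grothendieck property: every weak* convergent sequence of finitely supported
signed Radon measures is weakly convergent. -/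
def DeltaGrothendieck : Prop :=
  ∀ (μs : ℕ → SignedMeasure K) (μ : SignedMeasure K),
    (∀ n, IsRadon (μs n)) → (∀ n, (msupport (μs n)).Finite) →
    IsRadon μ → WeakStarTendsto μs μ → WeakTendsto μs μ

variable (K) in
/-- The finitely supported Josefson–Nissenzweig property: there is a weak* null sequence of
finitely supported signed Radon measures of total variation norm one. -/
def fsJNP : Prop :=
  ∃ μs : ℕ → SignedMeasure K,
    (∀ n, IsRadon (μs n)) ∧ (∀ n, (msupport (μs n)).Finite) ∧
    (∀ n, tvNorm (μs n) = 1) ∧ WeakStarNull μs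

variable (K) in
/-- The countably supported Josefson–Nissenzweig property: there is a weak* null sequence of
countably supported signed Radon measures of total variation norm one. -/
def csJNP : Prop :=
  ∃ μs : ℕ → SignedMeasure K,
    (∀ n, IsRadon (μs n)) ∧ (∀ n, (msupport (μs n)).Countable) ∧
    (∀ n, tvNorm (μs n) = 1) ∧ WeakStarNull μs

end JNP

namespace JNP

section

variable {X : Type*} [MeasurableSpace X]

theorem toJordanDecomposition_restrict_parts (μ : SignedMeasure X) {A : Set X}
    (hA : MeasurableSet A) :
    (SignedMeasure.toJordanDecomposition (μ.restrict A)).posPart =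
        μ.toJordanDecomposition.posPart.restrict A ∧
      (SignedMeasure.toJordanDecomposition (μ.restrict A)).negPart =
        μ.toJordanDecomposition.negPart.restrict A := by
  let j : JordanDecomposition X :=
    { posPart := μ.toJordanDecomposition.posPart.restrict A
      negPart := μ.toJordanDecomposition.negPart.restrict A
      posPart_finite := inferInstance
      negPart_finite := inferInstance
      mutuallySingular :=
        (μ.toJordanDecomposition.mutuallySingular.restrict A).symm.restrict A |>.symm }
  have hj : j.toSignedMeasure = μ.restrict A := by
    conv_rhs => rw [← μ.toSignedMeasure_toJordanDecomposition]
    ext B hB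
    simp [j, JordanDecomposition.toSignedMeasure, VectorMeasure.restrict_apply _ hA hB,
      hB, hB.inter hA, measureReal_def, Measure.restrict_apply]
  rw [← hj, j.toJordanDecomposition_toSignedMeasure]
  exact ⟨rfl, rfl⟩

theorem totalVariation_restrict (μ : SignedMeasure X) {A : Set X} (hA : MeasurableSet A) :
    SignedMeasure.totalVariation (μ.restrict A) = μ.totalVariation.restrict A := by
  obtain ⟨hp, hn⟩ := toJordanDecomposition_restrict_parts μ hA
  simp [SignedMeasure.totalVariation, hp, hn, Measure.restrict_add]

theorem exists_finite_measure_compl_lt [Nonempty X] [MeasurableSingletonClass X] (m : Measure X)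
    [IsFiniteMeasure m] {S : Set X} (hS : S.Countable) (hm : m Sᶜ = 0) {ε : ℝ≥0∞} (hε : 0 < ε) :
    ∃ F : Set X, F.Finite ∧ m Fᶜ < ε := by
  obtain ⟨f, hf⟩ := Set.countable_iff_exists_subset_range.1 hS
  have hanti : Antitone fun n : ℕ => (f '' Set.Iio n)ᶜ := fun a b hab =>
    Set.compl_subset_compl.2 (Set.image_mono (Set.Iio_subset_Iio hab))
  have hlim := tendsto_measure_iInter_atTop (μ := m)
    (fun n => (((Set.finite_Iio n).image f).measurableSet.compl).nullMeasurableSet) hanti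
    ⟨0, measure_ne_top _ _⟩
  have hzero : m (⋂ n : ℕ, (f '' Set.Iio n)ᶜ) = 0 := by
    refine measure_mono_null (t := Sᶜ) (fun x hx hxS => ?_) hm
    obtain ⟨k, rfl⟩ := hf hxS
    exact Set.mem_iInter.1 hx (k + 1) ⟨k, Nat.lt_succ_self k, rfl⟩
  rw [hzero] at hlim
  obtain ⟨n, hn⟩ := (hlim.eventually (gt_mem_nhds hε)).exists
  exact ⟨_, (Set.finite_Iio n).image f, hn⟩

instance isFiniteMeasure_totalVariation (μ : SignedMeasure X) :
    IsFiniteMeasure μ.totalVariation := by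
  unfold SignedMeasure.totalVariation
  infer_instance

theorem tvNorm_sub_restrict (μ : SignedMeasure X) {A : Set X} (hA : MeasurableSet A) :
    tvNorm (μ - μ.restrict A) = μ.totalVariation.real Aᶜ := by
  have h : μ - μ.restrict A = μ.restrict Aᶜ := by
    ext B hB
    rw [sub_apply, VectorMeasure.restrict_apply _ hA hB,
      VectorMeasure.restrict_apply _ hA.compl hB, sub_eq_iff_eq_add,
      ← VectorMeasure.of_union (Set.disjoint_left.2 fun x hx hx' => hx.2 hx'.2)
        (hB.inter hA.compl) (hB.inter hA), Set.union_comm, Set.inter_union_compl]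
  rw [h, tvNorm, totalVariation_restrict μ hA.compl, Measure.restrict_apply_univ, measureReal_def]

end

variable {K : Type*} [TopologicalSpace K] [MeasurableSpace K]

theorem IsRadon.totalVariation_compl_msupport {μ : SignedMeasure K} (hμ : IsRadon μ) :
    μ.totalVariation (msupport μ)ᶜ = 0 := by
  have : μ.totalVariation.Regular := hμ
  have hloc : ∀ x ∈ (msupport μ)ᶜ, ∃ U : Set K, IsOpen U ∧ x ∈ U ∧ μ.totalVariation U = 0 := by
    intro x hx
    simpa [msupport] using hx
  have hopen : IsOpen (msupport μ)ᶜ := by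
    refine isOpen_iff_forall_mem_open.2 fun x hx => ?_
    obtain ⟨U, hU, hxU, h0⟩ := hloc x hx
    exact ⟨U, fun y hy hys => hys U hU hy h0, hU, hxU⟩
  rw [hopen.measure_eq_iSup_isCompact]
  simp only [ENNReal.iSup_eq_zero]
  intro C hC hCc
  refine hCc.measure_zero_of_nhdsWithin fun x hx => ?_
  obtain ⟨U, hU, hxU, h0⟩ := hloc x (hC hx)
  exact ⟨U, mem_nhdsWithin_of_mem_nhds (hU.mem_nhds hxU), h0⟩

theorem Ell1Grothendieck.deltaGrothendieck (h : Ell1Grothendieck K) : DeltaGrothendieck K :=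
  fun μs μ hR hfin => h μs μ hR fun n => (hfin n).countable

variable [BorelSpace K]

theorem IsRadon.restrict [R1Space K] {μ : SignedMeasure K} (hμ : IsRadon μ) {A : Set K}
    (hA : MeasurableSet A) : IsRadon (μ.restrict A) := by
  unfold IsRadon at hμ ⊢
  rw [totalVariation_restrict μ hA]
  exact Measure.Regular.restrict_of_measure_ne_top (measure_ne_top _ _)

theorem msupport_restrict_subset (μ : SignedMeasure K) {A : Set K} (hA : IsClosed A) :
    msupport (μ.restrict A) ⊆ A := by
  intro x hx
  by_contra hxA
  refine hx Aᶜ hA.isOpen_compl hxA ?_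
  rw [totalVariation_restrict μ hA.measurableSet,
    Measure.restrict_apply hA.measurableSet.compl]
  simp

theorem abs_integ_sub_integ_restrict_le [CompactSpace K] (μ : SignedMeasure K) {A : Set K}
    (hA : MeasurableSet A) (f : C(K, ℝ)) :
    |integ μ f - integ (μ.restrict A) f| ≤ ‖f‖ * μ.totalVariation.real Aᶜ := by
  obtain ⟨hp, hn⟩ := toJordanDecomposition_restrict_parts μ hA
  have hint (m : Measure K) [IsFiniteMeasure m] : Integrable f m :=
    Integrable.of_bound f.continuous.measurable.aestronglyMeasurable ‖f‖
      (ae_of_all _ f.norm_coe_le_norm)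
  have hbound (m : Measure K) [IsFiniteMeasure m] : |∫ x in Aᶜ, f x ∂m| ≤ ‖f‖ * m.real Aᶜ :=
    norm_setIntegral_le_of_norm_le_const (measure_lt_top _ _) fun x _ => f.norm_coe_le_norm x
  have htv : μ.totalVariation.real Aᶜ = μ.toJordanDecomposition.posPart.real Aᶜ +
      μ.toJordanDecomposition.negPart.real Aᶜ := by
    exact measureReal_add_apply
  simp only [integ, hp, hn, htv]
  rw [← integral_add_compl hA (hint μ.toJordanDecomposition.posPart),
    ← integral_add_compl hA (hint μ.toJordanDecomposition.negPart)]
  have h1 := abs_le.1 (hbound μ.toJordanDecomposition.posPart)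
  have h2 := abs_le.1 (hbound μ.toJordanDecomposition.negPart)
  rw [abs_le]
  constructor <;> linarith [h1.1, h1.2, h2.1, h2.2]

theorem DeltaGrothendieck.ell1Grothendieck [CompactSpace K] [T2Space K] [Nonempty K]
    (h : DeltaGrothendieck K) : Ell1Grothendieck K := by
  intro μs μ hR hcount hμ hweak φ hφ
  choose F hfin hlt using fun n => exists_finite_measure_compl_lt (μs n).totalVariation (hcount n)
    (hR n).totalVariation_compl_msupport
    (ENNReal.ofReal_pos.2 (Nat.one_div_pos_of_nat (α := ℝ) (n := n)))
  have hsmall : Tendsto (fun n => (μs n).totalVariation.real (F n)ᶜ) atTop (𝓝 0) :=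
    squeeze_zero (fun _ => measureReal_nonneg)
      (fun n => ENNReal.toReal_le_of_le_ofReal Nat.one_div_pos_of_nat.le (hlt n).le)
      tendsto_one_div_add_atTop_nhds_zero_nat
  have hmeas n : MeasurableSet (F n) := (hfin n).measurableSet
  have hconv : WeakTendsto (fun n => (μs n).restrict (F n)) μ := by
    refine h _ μ (fun n => (hR n).restrict (hmeas n))
      (fun n => (hfin n).subset (msupport_restrict_subset _ (hfin n).isClosed)) hμ fun f => ?_
    have hdiff : Tendsto (fun n => integ (μs n) f - integ ((μs n).restrict (F n)) f)
        atTop (𝓝 0) :=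
      squeeze_zero_norm (fun n => abs_integ_sub_integ_restrict_le (μs n) (hmeas n) f)
        (by simpa using hsmall.const_mul ‖f‖)
    simpa using (hweak f).sub hdiff
  obtain ⟨C, hC⟩ := hφ
  have hdiff : Tendsto (fun n => φ (μs n - (μs n).restrict (F n))) atTop (𝓝 0) :=
    squeeze_zero_norm
      (fun n => (hC _).trans_eq (congrArg (C * ·) (tvNorm_sub_restrict (μs n) (hmeas n))))
      (by simpa using hsmall.const_mul C)
  simpa using hdiff.add (hconv φ ⟨C, hC⟩)

end JNP

/-- For an infinite compact Hausdorff space `K`, `C(K)` has the ℓ₁-Grothendieck property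
iff it has the Δ-Grothendieck property. -/
theorem stmt_0 (K : Type*) [TopologicalSpace K] [MeasurableSpace K] [BorelSpace K]
    [CompactSpace K] [T2Space K] [Infinite K] :
    JNP.Ell1Grothendieck K ↔ JNP.DeltaGrothendieck K := by
  exact ⟨fun h => h.deltaGrothendieck, fun h => h.ell1Grothendieck⟩
end

section
/- Every infinite compact Hausdorff space K admits a Josefson–Nissenzweig sequence, i.e. there exists a sequence ⟨μ_n⟩ of signed Radon measures on K such that ‖μ_n‖ = 1 for every n and ∫_K f dμ_n → 0 for every continuous function f : K → ℝ. -/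
open MeasureTheory Filter Topology Set
open scoped ENNReal

/-- The difference of two mutually singular finite regular measures of total mass one is a Radon
signed measure of norm one whose Jordan decomposition is the given one. -/
theorem JNP.exists_signedMeasure_of_mutuallySingular {K : Type*} [TopologicalSpace K]
    [MeasurableSpace K] [BorelSpace K] [T2Space K] (α β : Measure K) [IsFiniteMeasure α]
    [IsFiniteMeasure β] [α.InnerRegular] [β.InnerRegular] (hs : α ⟂ₘ β) (h1 : (α + β) univ = 1) :
    ∃ μ : SignedMeasure K, JNP.IsRadon μ ∧ JNP.tvNorm μ = 1 ∧
      ∀ f : K → ℝ, JNP.integ μ f = ∫ x, f x ∂α - ∫ x, f x ∂β := by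
  let j : JordanDecomposition K := ⟨α, β, hs⟩
  have hj : j.toSignedMeasure.toJordanDecomposition = j :=
    JordanDecomposition.toJordanDecomposition_toSignedMeasure j
  have hv : j.toSignedMeasure.totalVariation = α + β := by
    rw [SignedMeasure.totalVariation, hj]
  refine ⟨j.toSignedMeasure, ?_, ?_, fun f => ?_⟩
  · rw [JNP.IsRadon, hv]
    infer_instance
  · rw [JNP.tvNorm, hv, h1, ENNReal.toReal_one]
  · rw [JNP.integ, hj]

theorem MeasureTheory.Measure.innerRegular_dirac {K : Type*} [TopologicalSpace K]
    [MeasurableSpace K] [MeasurableSingletonClass K] (x : K) :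
    (Measure.dirac x).InnerRegular := by
  refine ⟨fun U hU r hr => ?_⟩
  by_cases hx : x ∈ U
  · refine ⟨{x}, by simpa using hx, isCompact_singleton, ?_⟩
    rw [Measure.dirac_apply_of_mem hx] at hr
    rwa [Measure.dirac_apply_of_mem (mem_singleton x)]
  · rw [Measure.dirac_apply' x hU, indicator_of_notMem hx] at hr
    simp at hr

/-- A nontrivial convergent sequence yields a Josefson–Nissenzweig sequence. -/
theorem JNP.exists_weakStarNull_of_tendsto {K : Type*} [TopologicalSpace K] [MeasurableSpace K]
    [BorelSpace K] [T2Space K] {u : ℕ → K} {x : K} (hne : ∀ n, u n ≠ x)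
    (hu : Tendsto u atTop (𝓝 x)) :
    ∃ μs : ℕ → SignedMeasure K,
      (∀ n, JNP.IsRadon (μs n)) ∧ (∀ n, JNP.tvNorm (μs n) = 1) ∧ JNP.WeakStarNull μs := by
  have key : ∀ n, ∃ μ : SignedMeasure K, JNP.IsRadon μ ∧ JNP.tvNorm μ = 1 ∧
      ∀ f : K → ℝ, JNP.integ μ f = (2⁻¹ : ℝ) * f (u n) - (2⁻¹ : ℝ) * f x := by
    intro n
    have := Measure.innerRegular_dirac (u n)
    have := Measure.innerRegular_dirac x
    have hs : (2⁻¹ : NNReal) • Measure.dirac (u n) ⟂ₘ (2⁻¹ : NNReal) • Measure.dirac x := by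
      refine ⟨{x}, measurableSet_singleton x, ?_, ?_⟩
      · simp [hne n]
      · simp
    obtain ⟨μ, hR, hn, hi⟩ := JNP.exists_signedMeasure_of_mutuallySingular _ _ hs (by
      simp only [Measure.coe_add, Pi.add_apply, Measure.smul_apply, measure_univ]
      simp only [ENNReal.smul_def, smul_eq_mul, mul_one]
      rw [ENNReal.coe_inv two_ne_zero]
      exact ENNReal.inv_two_add_inv_two)
    refine ⟨μ, hR, hn, fun f => ?_⟩
    rw [hi, integral_smul_nnreal_measure, integral_smul_nnreal_measure, integral_dirac,
      integral_dirac]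
    simp [NNReal.smul_def]
  choose μs hR hn hi using key
  refine ⟨μs, hR, hn, fun f => ?_⟩
  simp only [hi]
  have := (((f.continuous.tendsto x).comp hu).const_mul (2⁻¹ : ℝ)).sub_const ((2⁻¹ : ℝ) * f x)
  simpa using this

/-- An infinite compact Hausdorff space without nonempty preperfect subsets contains a nontrivial
convergent sequence. -/
theorem exists_tendsto_ne_of_forall_not_preperfect {K : Type*} [TopologicalSpace K]
    [CompactSpace K] [T2Space K] [Infinite K]
    (h : ∀ P : Set K, P.Nonempty → ¬ Preperfect P) :
    ∃ (u : ℕ → K) (x : K), (∀ n, u n ≠ x) ∧ Tendsto u atTop (𝓝 x) := by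
  let A : Set K := {x | ¬ IsOpen ({x} : Set K)}
  have hA : A.Nonempty := by
    by_contra hne
    have hd : DiscreteTopology K := discreteTopology_iff_isOpen_singleton.2 fun x => by
      by_contra hx
      exact hne ⟨x, hx⟩
    exact not_finite_iff_infinite.2 ‹Infinite K› finite_of_compact_of_discrete
  have hp := h A hA
  rw [preperfect_iff_nhds] at hp
  push Not at hp
  obtain ⟨x, hxA, U, hU, hUA⟩ := hp
  obtain ⟨V, hV, hVc, hVU⟩ := exists_mem_nhds_isClosed_subset hU
  have hinf : (V \ {x}).Infinite := by
    intro hfin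
    apply hxA
    have hmem : V ∩ (V \ {x})ᶜ ∈ 𝓝 x :=
      inter_mem hV (hfin.isClosed.isOpen_compl.mem_nhds (by simp))
    have : V ∩ (V \ {x})ᶜ ⊆ {x} := by
      rintro y ⟨hy, hy'⟩
      by_contra hyx
      exact hy' ⟨hy, hyx⟩
    exact (isOpen_singleton_iff_nhds_eq_pure x).2
      (le_antisymm (Filter.le_pure_iff.2 (mem_of_superset hmem this)) (pure_le_nhds x))
  let u := hinf.natEmbedding
  refine ⟨fun n => u n, x, fun n => (u n).2.2, ?_⟩
  rw [tendsto_nhds]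
  intro W hW hxW
  have hcomp : IsCompact (V \ W) := hVc.isCompact.diff hW
  have hfin : (V \ W).Finite := by
    refine hcomp.finite (isDiscrete_iff_forall_mem_exists_isOpen.2 fun y hy => ⟨{y}, ?_, ?_⟩)
    · by_contra hyA
      exact hy.2 (hUA y ⟨hVU hy.1, hyA⟩ ▸ hxW)
    · exact inter_eq_left.2 (singleton_subset_iff.2 hy)
  rw [← Nat.cofinite_eq_atTop, mem_cofinite]
  refine (hfin.preimage (f := fun n => (u n : K))
    (Subtype.val_injective.comp u.injective).injOn).subset fun n hn => ?_
  exact ⟨(u n).2.1, hn⟩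

/-- A finite family of open sets, each meeting a preperfect set, can be split by one continuous
function. -/
theorem Preperfect.exists_continuousMap_split {K : Type*} [TopologicalSpace K] [NormalSpace K]
    [T1Space K] {P : Set K} (hP : Preperfect P) (hne : P.Nonempty) {𝒲 : Set (Set K)}
    (hf : 𝒲.Finite)
    (hW : ∀ U ∈ 𝒲, IsOpen U ∧ (U ∩ P).Nonempty) :
    ∃ h : C(K, ℝ), ∀ U ∈ 𝒲,
      (U ∩ {x | 1 < h x} ∩ P).Nonempty ∧ (U ∩ {x | h x < -1} ∩ P).Nonempty := by
  have hinf : ∀ U ∈ 𝒲, (U ∩ P).Infinite := by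
    intro U hU
    obtain ⟨x, hx⟩ := (hW U hU).2
    exact Set.Infinite.of_accPt (hP.open_inter (hW U hU).1 x hx)
  have : Nonempty K := hne.to_type
  choose! a ha using fun U hU => (hW U hU).2
  have hF : (a '' 𝒲).Finite := hf.image a
  have hd : ∀ U ∈ 𝒲, ((U ∩ P) \ a '' 𝒲).Nonempty := fun U hU => ((hinf U hU).sdiff hF).nonempty
  choose! b hb using hd
  have hG : (b '' 𝒲).Finite := hf.image b
  obtain ⟨f, hf0, hf1, -⟩ := exists_continuous_zero_one_of_isClosed hF.isClosed hG.isClosed (by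
    rw [Set.disjoint_right]
    rintro _ ⟨U, hU, rfl⟩
    exact (hb U hU).2)
  refine ⟨(4 : ℝ) • f - ContinuousMap.const K 2, fun U hU => ⟨⟨b U, ⟨(hb U hU).1.1, ?_⟩, (hb U hU).1.2⟩,
    ⟨a U, ⟨(ha U hU).1, ?_⟩, (ha U hU).2⟩⟩⟩
  · have := hf1 (mem_image_of_mem b hU)
    simp only [Pi.one_apply] at this
    simp [this]
    norm_num
  · have := hf0 (mem_image_of_mem a hU)
    simp only [Pi.zero_apply] at this
    simp [this]

/-- On a nonempty preperfect set one can find a sequence of continuous functions realizing all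
finite sign patterns. -/
theorem Preperfect.exists_independent_seq {K : Type*} [TopologicalSpace K] [NormalSpace K]
    [T1Space K] {P : Set K} (hP : Preperfect P) (hne : P.Nonempty) :
    ∃ h : ℕ → C(K, ℝ), (∀ n x, |h n x| ≤ 1) ∧
      ∀ (n : ℕ) (σ : Fin n → Bool), ∃ x, ∀ i : Fin n, h i x = if σ i then 1 else -1 := by
  let S := {𝒲 : Set (Set K) // 𝒲.Finite ∧ ∀ U ∈ 𝒲, IsOpen U ∧ (U ∩ P).Nonempty}
  choose H hH using fun 𝒲 : S => hP.exists_continuousMap_split hne 𝒲.2.1 𝒲.2.2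
  let next : S → S := fun 𝒲 =>
    ⟨(fun U => U ∩ {x | 1 < H 𝒲 x}) '' 𝒲.1 ∪ (fun U => U ∩ {x | H 𝒲 x < -1}) '' 𝒲.1,
      (𝒲.2.1.image _).union (𝒲.2.1.image _), by
        rintro _ (⟨U, hU, rfl⟩ | ⟨U, hU, rfl⟩)
        · exact ⟨(𝒲.2.2 U hU).1.inter (isOpen_lt continuous_const (H 𝒲).continuous),
            (hH 𝒲 U hU).1⟩
        · exact ⟨(𝒲.2.2 U hU).1.inter (isOpen_lt (H 𝒲).continuous continuous_const),
            (hH 𝒲 U hU).2⟩⟩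
  let s₀ : S := ⟨{univ}, finite_singleton _, by simpa using hne⟩
  let s : ℕ → S := fun n => next^[n] s₀
  have hs : ∀ n, s (n + 1) = next (s n) := fun n => Function.iterate_succ_apply' next n s₀
  have key : ∀ (n : ℕ) (σ : Fin n → Bool), ∃ U ∈ (s n).1, ∀ x ∈ U, ∀ i : Fin n,
      if σ i then 1 < H (s i) x else H (s i) x < -1 := by
    intro n
    induction n with
    | zero => exact fun σ => ⟨univ, rfl, fun x _ i => i.elim0⟩
    | succ n ih =>
      intro σ
      obtain ⟨U, hU, hx⟩ := ih (fun i => σ i.castSucc)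
      rw [hs]
      cases hσ : σ (Fin.last n) with
      | true =>
        refine ⟨_, Or.inl ⟨U, hU, rfl⟩, fun x hxU i => ?_⟩
        induction i using Fin.lastCases with
        | last => simpa [hσ] using hxU.2
        | cast i => simpa using hx x hxU.1 i
      | false =>
        refine ⟨_, Or.inr ⟨U, hU, rfl⟩, fun x hxU i => ?_⟩
        induction i using Fin.lastCases with
        | last => simpa [hσ] using hxU.2
        | cast i => simpa using hx x hxU.1 i
  refine ⟨fun n => (H (s n) ⊓ 1) ⊔ (-1), fun n x => ?_, fun n σ => ?_⟩
  · rw [abs_le]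
    simp
  · obtain ⟨U, hU, hx⟩ := key n σ
    obtain ⟨x, hxU, -⟩ := ((s n).2.2 U hU).2
    refine ⟨x, fun i => ?_⟩
    have := hx x hxU i
    cases hσ : σ i with
    | true =>
      rw [hσ, if_pos rfl] at this
      simp [this.le]
    | false =>
      rw [hσ, if_neg (by simp)] at this
      simp [this.le]

/-- The averages over a sequence of finite families of points converge along any ultrafilter to
integration against a regular measure. -/
theorem exists_regular_measure_tendsto_ultrafilter {K : Type*} [TopologicalSpace K]
    [CompactSpace K] [T2Space K] [MeasurableSpace K] [BorelSpace K] {ι : ℕ → Type*}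
    [∀ n, Fintype (ι n)] [∀ n, Nonempty (ι n)] (p : ∀ n, ι n → K) (𝒰 : Ultrafilter ℕ) :
    ∃ μ : Measure K, μ.Regular ∧ IsFiniteMeasure μ ∧ ∀ g : C(K, ℝ),
      Tendsto (fun n => (∑ i, g (p n i)) / Fintype.card (ι n)) 𝒰 (𝓝 (∫ x, g x ∂μ)) := by
  let av : C(K, ℝ) → ℕ → ℝ := fun g n => (∑ i, g (p n i)) / Fintype.card (ι n)
  have hlim : ∀ g : C(K, ℝ), ∃ l, Tendsto (av g) 𝒰 (𝓝 l) := by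
    intro g
    have hb : ∀ n, av g n ∈ Icc (-‖g‖) ‖g‖ := by
      intro n
      have hc : (0 : ℝ) < Fintype.card (ι n) := by exact_mod_cast Fintype.card_pos
      rw [mem_Icc, ← abs_le, abs_div, abs_of_pos hc, div_le_iff₀ hc]
      calc |∑ i, g (p n i)| ≤ ∑ i, |g (p n i)| := Finset.abs_sum_le_sum_abs _ _
        _ ≤ ∑ _i : ι n, ‖g‖ := Finset.sum_le_sum fun i _ => g.norm_coe_le_norm _
        _ = ‖g‖ * Fintype.card (ι n) := by simp [mul_comm]
    obtain ⟨l, -, hl⟩ := isCompact_Icc.ultrafilter_le_nhds (𝒰.map (av g))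
      (le_principal_iff.2 (Filter.mem_map.2 (Filter.univ_mem' hb)))
    exact ⟨l, hl⟩
  choose L hL using hlim
  have hadd : ∀ f g, L (f + g) = L f + L g := fun f g =>
    tendsto_nhds_unique (hL _) (((hL f).add (hL g)).congr fun n => by
      simp [av, Finset.sum_add_distrib, add_div])
  have hsmul : ∀ (c : ℝ) f, L (c • f) = c • L f := fun c f =>
    tendsto_nhds_unique (hL _) (((hL f).const_mul c).congr fun n => by
      simp [av, ← Finset.mul_sum, mul_div_assoc])
  have hpos : ∀ f : C(K, ℝ), (∀ x, 0 ≤ f x) → 0 ≤ L f := fun f hf =>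
    ge_of_tendsto' (hL f) fun n => div_nonneg (Finset.sum_nonneg fun i _ => hf _) (by positivity)
  let Λ : CompactlySupportedContinuousMap K ℝ →ₚ[ℝ] ℝ := PositiveLinearMap.mk₀
    { toFun := fun f => L f.toContinuousMap
      map_add' := fun f g => hadd _ _
      map_smul' := fun c f => hsmul _ _ } fun f hf => hpos _ hf
  refine ⟨RealRMK.rieszMeasure Λ, inferInstance, inferInstance, fun g => ?_⟩
  have h := RealRMK.integral_rieszMeasure Λ (CompactlySupportedContinuousMap.continuousMapEquiv g)
  have h' : ∫ x, g x ∂(RealRMK.rieszMeasure Λ) = L g := h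
  rw [h']
  exact hL g

/-- Distinct coordinate signs on the cube are orthogonal. -/
theorem sum_sign_mul_sign_eq_zero {ι : Type*} [Fintype ι] [DecidableEq ι] {i j : ι} (hij : i ≠ j) :
    ∑ σ : ι → Bool, (if σ i then (1 : ℝ) else -1) * (if σ j then 1 else -1) = 0 := by
  have hinv : Function.Involutive
      fun σ : ι → Bool => Function.update σ i (!σ i) := fun σ => by simp
  have h := Equiv.sum_comp (hinv.toPerm _)
    fun σ : ι → Bool => (if σ i then (1 : ℝ) else -1) * (if σ j then 1 else -1)
  have h' : ∑ σ : ι → Bool, (if (hinv.toPerm _ σ) i then (1 : ℝ) else -1) *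
      (if (hinv.toPerm _ σ) j then 1 else -1) =
      -∑ σ : ι → Bool, (if σ i then (1 : ℝ) else -1) * (if σ j then 1 else -1) := by
    rw [← Finset.sum_neg_distrib]
    refine Finset.sum_congr rfl fun σ _ => ?_
    simp only [Function.Involutive.coe_toPerm, Function.update_self,
      Function.update_of_ne hij.symm]
    cases σ i <;> cases σ j <;> simp
  linarith

/-- A sequence of continuous functions realizing all finite sign patterns is orthonormal with
respect to some regular probability measure. -/
theorem exists_regular_measure_orthonormal {K : Type*} [TopologicalSpace K]
    [CompactSpace K] [T2Space K] [MeasurableSpace K] [BorelSpace K] {h : ℕ → C(K, ℝ)}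
    (hσ : ∀ (n : ℕ) (σ : Fin n → Bool), ∃ x, ∀ i : Fin n, h i x = if σ i then 1 else -1) :
    ∃ μ : Measure K, μ.Regular ∧ IsProbabilityMeasure μ ∧
      ∀ i j, ∫ x, h i x * h j x ∂μ = if i = j then 1 else 0 := by
  choose p hp using hσ
  obtain ⟨μ, hR, hfin, hμ⟩ := exists_regular_measure_tendsto_ultrafilter p (hyperfilter ℕ)
  refine ⟨μ, hR, ⟨?_⟩, fun i j => ?_⟩
  · have h1 := hμ 1
    have h2 : ∫ x, (1 : C(K, ℝ)) x ∂μ = 1 :=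
      tendsto_nhds_unique h1 (tendsto_const_nhds.congr fun n => by simp)
    simpa [measureReal_def, ENNReal.toReal_eq_one_iff] using h2
  · refine tendsto_nhds_unique (hμ (h i * h j)) (tendsto_const_nhds.congr' ?_)
    have hev : ∀ᶠ n in (hyperfilter ℕ : Filter ℕ), max i j < n :=
      Nat.hyperfilter_le_atTop (eventually_gt_atTop _)
    filter_upwards [hev] with n hn
    obtain ⟨hi, hj⟩ := max_lt_iff.1 hn
    have hsum : ∑ σ, (h i * h j) (p n σ) = ∑ σ : Fin n → Bool,
        (if σ ⟨i, hi⟩ then (1 : ℝ) else -1) * (if σ ⟨j, hj⟩ then 1 else -1) := by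
      refine Finset.sum_congr rfl fun σ _ => ?_
      rw [ContinuousMap.mul_apply, ← hp n σ ⟨i, hi⟩, ← hp n σ ⟨j, hj⟩]
    rw [hsum]
    split_ifs with hij
    · subst hij
      have : ∀ σ : Fin n → Bool,
          (if σ ⟨i, hi⟩ then (1 : ℝ) else -1) * (if σ ⟨i, hj⟩ then 1 else -1) = 1 := by
        intro σ
        cases σ ⟨i, hi⟩ <;> simp
      simp [this]
    · rw [sum_sign_mul_sign_eq_zero (by simpa using hij), zero_div]

/-- An orthonormal sequence of continuous functions with absolute value at most one yields a
Josefson–Nissenzweig sequence. -/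
theorem JNP.exists_weakStarNull_of_orthonormal {K : Type*} [TopologicalSpace K]
    [CompactSpace K] [T2Space K] [MeasurableSpace K] [BorelSpace K] {h : ℕ → C(K, ℝ)}
    (hb : ∀ n x, |h n x| ≤ 1) (μ : Measure K) [μ.Regular] [IsProbabilityMeasure μ]
    (ho : ∀ i j, ∫ x, h i x * h j x ∂μ = if i = j then 1 else 0) :
    ∃ μs : ℕ → SignedMeasure K,
      (∀ n, JNP.IsRadon (μs n)) ∧ (∀ n, JNP.tvNorm (μs n) = 1) ∧ JNP.WeakStarNull μs := by
  have hf_int : ∀ f : C(K, ℝ), Integrable f μ := fun f =>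
    f.continuous.integrable_of_hasCompactSupport (HasCompactSupport.of_compactSpace f)
  have key : ∀ n, ∃ ν : SignedMeasure K, JNP.IsRadon ν ∧ JNP.tvNorm ν = 1 ∧
      ∀ f : C(K, ℝ), JNP.integ ν f = ∫ x, f x * h n x ∂μ := by
    intro n
    let A : Set K := {x | h n x = 1}
    let B : Set K := {x | h n x = -1}
    have hA : MeasurableSet A :=
      (isClosed_eq (h n).continuous continuous_const).measurableSet
    have hB : MeasurableSet B :=
      (isClosed_eq (h n).continuous continuous_const).measurableSet
    have hAB : Disjoint A B := Set.disjoint_left.2 fun x (hx : _ = _) (hx' : _ = _) => by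
      linarith
    have hae : ∀ᵐ x ∂μ, x ∈ A ∪ B := by
      have h0 : ∫ x, (1 - h n * h n : C(K, ℝ)) x ∂μ = 0 := by
        have hsub : ∫ x, ((1 : ℝ) - h n x * h n x) ∂μ = ∫ _x, (1 : ℝ) ∂μ -
            ∫ x, h n x * h n x ∂μ := integral_sub (integrable_const 1) (hf_int (h n * h n))
        simpa [ho] using hsub
      have h1 := (integral_eq_zero_iff_of_nonneg (fun x => by
        have := abs_le_one_iff_mul_self_le_one.1 (hb n x)
        simpa using this) (hf_int _)).1 h0
      filter_upwards [h1] with x hx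
      have : h n x * h n x = 1 := by
        have : 1 - h n x * h n x = 0 := hx
        linarith
      exact mul_self_eq_one_iff.1 this
    have hsum : μ.restrict A + μ.restrict B = μ := by
      rw [← Measure.restrict_union hAB hB, Measure.restrict_eq_self_of_ae_mem hae]
    have hs : μ.restrict A ⟂ₘ μ.restrict B := by
      refine ⟨B, hB, ?_, ?_⟩
      · rw [Measure.restrict_apply hB, inter_comm, hAB.inter_eq, measure_empty]
      · rw [Measure.restrict_apply hB.compl, compl_inter_self, measure_empty]
    obtain ⟨ν, hR, hn, hi⟩ := JNP.exists_signedMeasure_of_mutuallySingular _ _ hs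
      (by rw [hsum, measure_univ])
    refine ⟨ν, hR, hn, fun f => ?_⟩
    have hfn : Integrable (fun x => f x * h n x) μ := hf_int (f * h n)
    have hun : ∫ x, f x * h n x ∂μ = ∫ x in A ∪ B, f x * h n x ∂μ := by
      rw [Measure.restrict_eq_self_of_ae_mem hae]
    rw [hi, hun, setIntegral_union hAB hB hfn.integrableOn hfn.integrableOn, sub_eq_add_neg,
      ← integral_neg]
    congr 1
    · exact setIntegral_congr_fun hA fun x (hx : h n x = 1) => by simp [hx]
    · exact setIntegral_congr_fun hB fun x (hx : h n x = -1) => by simp [hx]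
  choose μs hR hn hi using key
  refine ⟨μs, hR, hn, fun f => ?_⟩
  simp only [hi]
  have hon : Orthonormal ℝ fun n => ContinuousMap.toLp 2 μ ℝ (h n) := by
    rw [orthonormal_iff_ite]
    intro i j
    rw [ContinuousMap.inner_toLp]
    simpa [mul_comm] using ho i j
  have hsq := (hon.inner_products_summable (ContinuousMap.toLp 2 μ ℝ f)).tendsto_atTop_zero
  have hsqrt := (Real.continuous_sqrt.tendsto 0).comp hsq
  rw [tendsto_zero_iff_norm_tendsto_zero]
  simpa [Function.comp_def, ContinuousMap.inner_toLp, Real.sqrt_sq_eq_abs] using hsqrt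

/-- The Josefson–Nissenzweig theorem for `C(K)`-spaces: every infinite compact Hausdorff
space admits a weak* null sequence of signed Radon measures of total variation norm one. -/
theorem stmt_3 (K : Type*) [TopologicalSpace K] [MeasurableSpace K] [BorelSpace K]
    [CompactSpace K] [T2Space K] [Infinite K] :
    ∃ μs : ℕ → MeasureTheory.SignedMeasure K,
      (∀ n, JNP.IsRadon (μs n)) ∧ (∀ n, JNP.tvNorm (μs n) = 1) ∧ JNP.WeakStarNull μs := by
  by_cases h : ∃ P : Set K, P.Nonempty ∧ Preperfect P
  · obtain ⟨P, hne, hP⟩ := h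
    obtain ⟨f, hb, hσ⟩ := hP.exists_independent_seq hne
    obtain ⟨μ, hR, hμ, ho⟩ := exists_regular_measure_orthonormal hσ
    exact JNP.exists_weakStarNull_of_orthonormal hb μ ho
  · push Not at h
    obtain ⟨u, x, hne, hu⟩ := exists_tendsto_ne_of_forall_not_preperfect h
    exact JNP.exists_weakStarNull_of_tendsto hne hu
end

section
/- Let K be a totally disconnected compact Hausdorff space, μ a Radon probability measure on K, and ⟨A_n⟩ a sequence of pairwise disjoint clopen subsets of K with μ(A_n) > 0 for every n. Define F to be the set of all x ∈ K such that for every clopen neighborhood U of x one has limsup_{n→∞} μ(A_n ∩ U)/μ(A_n) > 0. Then F is closed and nonempty, and the quotient space K/F, obtained from K by collapsing F to a single point, does not have the Grothendieck property. -/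
open MeasureTheory Filter Topology Set
open scoped ENNReal

/-- The setoid collapsing a subset `F` of `K` to a single point. -/
def collapseSetoid {K : Type*} (F : Set K) : Setoid K where
  r x y := x = y ∨ (x ∈ F ∧ y ∈ F)
  iseqv := by
    refine ⟨fun x => Or.inl rfl, ?_, ?_⟩
    · rintro x y (rfl | ⟨hx, hy⟩)
      · exact Or.inl rfl
      · exact Or.inr ⟨hy, hx⟩
    · rintro x y z (rfl | ⟨hx, hy⟩) h2
      · exact h2
      · rcases h2 with rfl | ⟨hy', hz⟩
        · exact Or.inr ⟨hx, hy⟩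
        · exact Or.inr ⟨hx, hz⟩

namespace JNP

section SignedOfPositive

variable {L : Type*} [MeasurableSpace L]

theorem toJordanDecomposition_of_measure (ν : Measure L) [IsFiniteMeasure ν] :
    ν.toSignedMeasure.toJordanDecomposition =
      { posPart := ν, negPart := 0, mutuallySingular := Measure.MutuallySingular.zero_right } := by
  apply SignedMeasure.toJordanDecomposition_eq
  simp [JordanDecomposition.toSignedMeasure]

theorem totalVariation_of_measure (ν : Measure L) [IsFiniteMeasure ν] :
    ν.toSignedMeasure.totalVariation = ν := by
  simp [SignedMeasure.totalVariation, toJordanDecomposition_of_measure]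

theorem integ_of_measure [TopologicalSpace L] (ν : Measure L) [IsFiniteMeasure ν] (f : L → ℝ) :
    integ ν.toSignedMeasure f = ∫ x, f x ∂ν := by
  simp [integ, toJordanDecomposition_of_measure]

/-- Evaluation at a set is a bounded linear functional for the total variation norm. -/
theorem WeakTendsto.tendsto_apply [TopologicalSpace L] {μs : ℕ → SignedMeasure L}
    {μ : SignedMeasure L} (h : WeakTendsto μs μ) (s : Set L) :
    Tendsto (fun n => μs n s) atTop (𝓝 (μ s)) := by
  refine h { toFun := fun ν => ν s, map_add' := fun _ _ => rfl, map_smul' := fun _ _ => rfl }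
    ⟨1, fun ν => ?_⟩
  rw [one_mul]
  exact (ν.norm_le_totalVariation s).trans (measureReal_mono (subset_univ s))

end SignedOfPositive

/-- A sequence of probability measures which is weak* convergent to a Dirac measure at a point
of measure zero for every term witnesses the failure of the Grothendieck property. -/
theorem not_grothendieckProp_of_tendsto_dirac {L : Type*} [TopologicalSpace L] [T1Space L]
    [MeasurableSpace L] [BorelSpace L] (ν : ℕ → Measure L) [∀ n, IsProbabilityMeasure (ν n)]
    (hreg : ∀ n, (ν n).Regular) (p : L) (hreg_p : (Measure.dirac p).Regular)
    (hp : ∀ n, ν n {p} = 0)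
    (hlim : ∀ f : C(L, ℝ), Tendsto (fun n => ∫ x, f x ∂ν n) atTop (𝓝 (f p))) :
    ¬ GrothendieckProp L := by
  intro hG
  have hw := hG (fun n => (ν n).toSignedMeasure) (Measure.dirac p).toSignedMeasure
    (fun n => by simpa only [IsRadon, totalVariation_of_measure] using hreg n)
    (by simpa only [IsRadon, totalVariation_of_measure] using hreg_p)
    (fun f => by simpa only [integ_of_measure, integral_dirac] using hlim f)
  have h := hw.tendsto_apply {p}
  have hm : MeasurableSet ({p} : Set L) := measurableSet_singleton p
  simp [Measure.toSignedMeasure_apply_measurable hm, measureReal_def, hp] at h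

end JNP

theorem preimage_singleton_collapse {K : Type*} {F : Set K} {x : K} (hx : x ∈ F) :
    Quotient.mk (collapseSetoid F) ⁻¹' {Quotient.mk _ x} = F := by
  ext y
  rw [mem_preimage, mem_singleton_iff, Quotient.eq]
  constructor
  · rintro (rfl | ⟨hy, -⟩)
    exacts [hx, hy]
  · exact fun hy => Or.inr ⟨hy, hx⟩

section Collapse

variable {K : Type*} [TopologicalSpace K]

theorem isClopen_setOf_lift_collapse {F U : Set K} (hU : IsClopen U) (hUF : Disjoint U F) :
    ∃ V : Set (Quotient (collapseSetoid F)), IsClopen V ∧ Quotient.mk _ ⁻¹' V = U := by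
  have hsat : ∀ x y : K, (collapseSetoid F) x y → (x ∈ U) = (y ∈ U) := by
    rintro x y (rfl | ⟨hx, hy⟩)
    · rfl
    · simp [hUF.notMem_of_mem_right hx, hUF.notMem_of_mem_right hy]
  have hV : Quotient.mk (collapseSetoid F) ⁻¹' {q | Quotient.lift (· ∈ U) hsat q} = U := rfl
  refine ⟨_, isQuotientMap_quotient_mk'.isClopen_preimage.1 ?_, hV⟩
  exact hU

/-- Collapsing a closed subset of a profinite space yields a Hausdorff space. -/
theorem t2Space_collapse [CompactSpace K] [T2Space K] [TotallyDisconnectedSpace K]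
    {F : Set K} (hF : IsClosed F) : T2Space (Quotient (collapseSetoid F)) := by
  have key : ∀ x y : K, x ≠ y → x ∉ F → ∃ V : Set (Quotient (collapseSetoid F)),
      IsClopen V ∧ Quotient.mk _ x ∈ V ∧ Quotient.mk _ y ∉ V := by
    intro x y hxy hx
    obtain ⟨U, hU, hxU, hUsub⟩ := compact_exists_isClopen_in_isOpen
      (hF.union isClosed_singleton).isOpen_compl (x := x) (U := (F ∪ {y})ᶜ) (by simp [hx, hxy])
    obtain ⟨V, hV, rfl⟩ := isClopen_setOf_lift_collapse (F := F) hU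
      (disjoint_left.2 fun z hz hzF => hUsub hz (Or.inl hzF))
    exact ⟨V, hV, hxU, fun hy => hUsub hy (Or.inr rfl)⟩
  refine ⟨fun a b => ?_⟩
  induction a, b using Quotient.inductionOn₂ with | _ x y => ?_
  intro hab
  have hxy : x ≠ y := fun h => hab (h ▸ rfl)
  by_cases hx : x ∈ F
  · have hy : y ∉ F := fun hy => hab (Quotient.sound (Or.inr ⟨hx, hy⟩))
    obtain ⟨V, hV, hyV, hxV⟩ := key y x hxy.symm hy
    exact ⟨Vᶜ, V, hV.compl.isOpen, hV.isOpen, hxV, hyV, disjoint_compl_left⟩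
  · obtain ⟨V, hV, hxV, hyV⟩ := key x y hxy hx
    exact ⟨V, Vᶜ, hV.isOpen, hV.compl.isOpen, hxV, hyV, disjoint_compl_right⟩

end Collapse

section Concentration

variable {K : Type*} [TopologicalSpace K] [MeasurableSpace K] {ν : ℕ → Measure K}
  [∀ n, IsProbabilityMeasure (ν n)] {F : Set K}

theorem tendsto_measureReal_of_isCompact
    (h : ∀ x ∉ F, ∃ U ∈ 𝓝 x, Tendsto (fun n => (ν n).real U) atTop (𝓝 0))
    {C : Set K} (hC : IsCompact C) (hCF : Disjoint C F) :
    Tendsto (fun n => (ν n).real C) atTop (𝓝 0) := by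
  refine hC.induction_on (p := fun s => Tendsto (fun n => (ν n).real s) atTop (𝓝 0))
    (by simp) ?_ ?_ ?_
  · intro s t hst ht
    exact squeeze_zero (fun _ => measureReal_nonneg) (fun _ => measureReal_mono hst) ht
  · intro s t hs ht
    exact squeeze_zero (fun _ => measureReal_nonneg) (fun n => measureReal_union_le s t)
      (by simpa using hs.add ht)
  · intro x hx
    obtain ⟨U, hU, hlim⟩ := h x (hCF.notMem_of_mem_left hx)
    exact ⟨U, mem_nhdsWithin_of_mem_nhds hU, hlim⟩

theorem nonempty_of_tendsto_measureReal [CompactSpace K]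
    (h : ∀ x ∉ F, ∃ U ∈ 𝓝 x, Tendsto (fun n => (ν n).real U) atTop (𝓝 0)) : F.Nonempty := by
  by_contra hne
  rw [not_nonempty_iff_eq_empty] at hne
  have := tendsto_measureReal_of_isCompact h isCompact_univ (by simp [hne])
  simp at this

theorem tendsto_integral_of_eqOn_const [CompactSpace K] [BorelSpace K]
    (h : ∀ x ∉ F, ∃ U ∈ 𝓝 x, Tendsto (fun n => (ν n).real U) atTop (𝓝 0))
    (g : C(K, ℝ)) {c : ℝ} (hg : ∀ x ∈ F, g x = c) :
    Tendsto (fun n => ∫ x, g x ∂ν n) atTop (𝓝 c) := by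
  have hcont : Continuous fun x => |g x - c| := by fun_prop
  obtain ⟨M, hM⟩ := (isCompact_range hcont).bddAbove
  rw [Metric.tendsto_atTop]
  intro ε hε
  set C : Set K := {x | ε / 2 ≤ |g x - c|} with hCdef
  have hC : IsClosed C := isClosed_le continuous_const hcont
  have hlim := (tendsto_measureReal_of_isCompact h hC.isCompact
    (disjoint_left.2 fun x hx hxF => by
      simp only [hCdef, mem_ofPred_eq, hg x hxF, sub_self, abs_zero] at hx
      linarith)).const_mul M
  rw [mul_zero] at hlim
  obtain ⟨N, hN⟩ := eventually_atTop.1 (hlim.eventually_lt_const (half_pos hε))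
  refine ⟨N, fun n hn => ?_⟩
  have hint : ∀ f : K → ℝ, Continuous f → Integrable f (ν n) := fun f hf =>
    hf.integrable_of_hasCompactSupport (HasCompactSupport.of_compactSpace f)
  have hind : Integrable (C.indicator fun _ => M) (ν n) :=
    (integrable_const M).indicator hC.measurableSet
  have hsub : (∫ x, g x ∂ν n) - c = ∫ x, (g x - c) ∂ν n := by
    rw [integral_sub (hint _ g.continuous) (integrable_const c)]
    simp
  have hbound : ∫ x, |g x - c| ∂ν n ≤ ∫ x, (ε / 2 + C.indicator (fun _ => M) x) ∂ν n := by
    refine integral_mono (hint _ hcont) ((integrable_const _).add hind) fun x => ?_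
    by_cases hx : x ∈ C
    · have := hM (mem_range_self x)
      simp only [indicator_of_mem hx]
      linarith
    · have : |g x - c| < ε / 2 := not_le.1 hx
      simp only [indicator_of_notMem hx]
      linarith
  have hval : ∫ x, (ε / 2 + C.indicator (fun _ => M) x) ∂ν n = ε / 2 + M * (ν n).real C := by
    rw [integral_add (integrable_const _) hind, integral_indicator hC.measurableSet]
    simp [mul_comm]
  rw [Real.dist_eq, hsub]
  have := hN n hn
  have := abs_integral_le_integral_abs (f := fun x => g x - c) (μ := ν n)
  linarith

end Concentration

theorem regular_map_of_continuous {K L : Type*} [TopologicalSpace K] [MeasurableSpace K]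
    [BorelSpace K] [TopologicalSpace L] [MeasurableSpace L] [BorelSpace L] [R1Space L]
    {q : K → L} (hq : Continuous q) (ν : Measure K) [IsFiniteMeasure ν]
    [ν.InnerRegularCompactLTTop] : (ν.map q).Regular := by
  have := Measure.InnerRegularCompactLTTop.map_of_continuous (μ := ν) hq
  infer_instance

theorem innerRegular_dirac {L : Type*} [TopologicalSpace L] [MeasurableSpace L] [T1Space L]
    [OpensMeasurableSpace L] (p : L) : (Measure.dirac p).InnerRegular := by
  refine ⟨fun s hs r hr => ?_⟩
  by_cases hp : p ∈ s
  · refine ⟨{p}, singleton_subset_iff.2 hp, isCompact_singleton, ?_⟩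
    simpa [hs, hp] using hr
  · simp [hs, hp] at hr

theorem tendsto_zero_of_limsup_nonpos {u : ℕ → ℝ} {b : ℝ} (h0 : ∀ n, 0 ≤ u n)
    (hb : ∀ n, u n ≤ b) (h : limsup u atTop ≤ 0) : Tendsto u atTop (𝓝 0) := by
  have hbdd : IsBoundedUnder (· ≤ ·) atTop u := isBoundedUnder_of ⟨b, hb⟩
  have hbdd' : IsBoundedUnder (· ≥ ·) atTop u := isBoundedUnder_of ⟨0, h0⟩
  exact tendsto_of_le_liminf_of_limsup_le
    (le_liminf_of_le hbdd.isCoboundedUnder_ge (Eventually.of_forall h0)) h hbdd hbdd'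

/-- Lemma 5.1: for a totally disconnected compact Hausdorff space `K`, a Radon probability
measure `μ` and pairwise disjoint clopen sets `A n` of positive measure, the set `F` of points
all of whose clopen neighbourhoods `U` satisfy `limsup μ(Aₙ ∩ U)/μ(Aₙ) > 0` is closed and
nonempty, and the quotient `K/F` does not have the Grothendieck property. -/
theorem stmt_5 {K : Type*} [TopologicalSpace K] [MeasurableSpace K] [BorelSpace K]
    [CompactSpace K] [T2Space K] [TotallyDisconnectedSpace K]
    (μ : MeasureTheory.Measure K) [MeasureTheory.IsProbabilityMeasure μ] [μ.Regular]
    (A : ℕ → Set K) (hclopen : ∀ n, IsClopen (A n))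
    (hdisj : ∀ n m, n ≠ m → Disjoint (A n) (A m))
    (hpos : ∀ n, 0 < μ (A n))
    (F : Set K)
    (hF : F = {x : K | ∀ U : Set K, IsClopen U → x ∈ U →
      0 < Filter.limsup (fun n => (μ (A n ∩ U)).toReal / (μ (A n)).toReal) Filter.atTop}) :
    IsClosed F ∧ F.Nonempty ∧
      (letI : MeasurableSpace (Quotient (collapseSetoid F)) := borel _
       haveI : BorelSpace (Quotient (collapseSetoid F)) := ⟨rfl⟩
       ¬ JNP.GrothendieckProp (Quotient (collapseSetoid F))) := by
  have hratio : ∀ (U : Set K) (n : ℕ),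
      (μ (A n ∩ U)).toReal / (μ (A n)).toReal = (ProbabilityTheory.cond μ (A n)).real U := by
    intro U n
    rw [measureReal_def, ProbabilityTheory.cond_apply (hclopen n).isOpen.measurableSet, ENNReal.toReal_mul,
      ENNReal.toReal_inv, div_eq_inv_mul]
  simp only [hratio] at hF
  set ν : ℕ → Measure K := fun n => ProbabilityTheory.cond μ (A n) with hν
  have hprob : ∀ n, IsProbabilityMeasure (ν n) := fun n =>
    ProbabilityTheory.cond_isProbabilityMeasure (hpos n).ne'
  have hout : ∀ x ∉ F, ∃ U, IsClopen U ∧ x ∈ U ∧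
      limsup (fun n => (ν n).real U) atTop ≤ 0 := by
    intro x hx
    rw [hF] at hx
    simpa using hx
  have hclosed : IsClosed F := by
    rw [← isOpen_compl_iff, isOpen_iff_mem_nhds]
    intro x hx
    obtain ⟨U, hU, hxU, hlim⟩ := hout x hx
    refine mem_of_superset (hU.isOpen.mem_nhds hxU) fun y hy hyF => ?_
    rw [hF] at hyF
    exact (hyF U hU hy).not_ge hlim
  have hnull : ∀ x ∉ F, ∃ U ∈ 𝓝 x, Tendsto (fun n => (ν n).real U) atTop (𝓝 0) := by
    intro x hx
    obtain ⟨U, hU, hxU, hlim⟩ := hout x hx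
    exact ⟨U, hU.isOpen.mem_nhds hxU, tendsto_zero_of_limsup_nonpos
      (fun _ => measureReal_nonneg) (fun _ => measureReal_le_one) hlim⟩
  have hne : F.Nonempty := nonempty_of_tendsto_measureReal hnull
  refine ⟨hclosed, hne, ?_⟩
  let _ : MeasurableSpace (Quotient (collapseSetoid F)) := borel _
  have : BorelSpace (Quotient (collapseSetoid F)) := ⟨rfl⟩
  obtain ⟨x₀, hx₀⟩ := hne
  have hAF : ∀ n, Disjoint (A n) F := by
    refine fun n => disjoint_left.2 fun x hx hxF => ?_
    rw [hF] at hxF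
    refine (hxF (A n) (hclopen n) hx).ne' (Tendsto.limsup_eq ?_)
    refine tendsto_const_nhds.congr' ?_
    filter_upwards [eventually_gt_atTop n] with m hm
    rw [← hratio, (hdisj m n hm.ne').inter_eq]
    simp
  have hT2 : T2Space (Quotient (collapseSetoid F)) := t2Space_collapse hclosed
  have hq : Continuous (Quotient.mk (collapseSetoid F)) := continuous_quotient_mk'
  have hprob' : ∀ n, IsProbabilityMeasure ((ν n).map (Quotient.mk (collapseSetoid F))) :=
    fun n => Measure.isProbabilityMeasure_map hq.aemeasurable
  refine JNP.not_grothendieckProp_of_tendsto_dirac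
    (fun n => (ν n).map (Quotient.mk (collapseSetoid F))) (fun n => ?_) (Quotient.mk _ x₀) ?_
    (fun n => ?_) fun f => ?_
  · have : (ν n).InnerRegularCompactLTTop := by
      rw [hν]
      unfold ProbabilityTheory.cond
      infer_instance
    exact regular_map_of_continuous hq (ν n)
  · have := innerRegular_dirac (Quotient.mk (collapseSetoid F) x₀)
    infer_instance
  · rw [Measure.map_apply hq.measurable (measurableSet_singleton _),
      preimage_singleton_collapse hx₀, ProbabilityTheory.cond_apply (hclopen n).isOpen.measurableSet,
      (hAF n).inter_eq]
    simp
  · have hint : ∀ n, ∫ y, f y ∂((ν n).map (Quotient.mk (collapseSetoid F))) =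
        ∫ x, f (Quotient.mk _ x) ∂ν n := fun n =>
      integral_map hq.aemeasurable f.continuous.aestronglyMeasurable
    simp only [hint]
    exact tendsto_integral_of_eqOn_const hnull (f.comp ⟨_, hq⟩)
      fun x hx => congrArg f (Quotient.sound (Or.inr ⟨hx, hx₀⟩))
end

section
/- Let K be a basically disconnected compact Hausdorff space, μ a Radon probability measure on K, and ⟨A_n⟩ a sequence of pairwise disjoint clopen subsets of K with μ(A_n) > 0 for every n. Let Z denote the family of all clopen subsets C of K such that lim_{n→∞} μ(A_n ∩ C)/μ(A_n) = 0. Then Z has the following pseudo-union property: for every sequence ⟨C_n⟩ of elements of Z there exists C ∈ Z such that for every n ∈ ω there is m ∈ ω with C_n \ C ⊆ A_0 ∪ A_1 ∪ … ∪ A_m. -/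
open MeasureTheory Filter Topology Set
open scoped ENNReal

/-- A subset of a topological space is a zero set if it is the preimage of `{0}` under a
continuous real-valued function. -/
def IsZeroSet {X : Type*} [TopologicalSpace X] (A : Set X) : Prop :=
  ∃ f : C(X, ℝ), A = f ⁻¹' {0}

/-- A topological space is basically disconnected if the closure of every cozero set is open. -/
def BasicallyDisconnected (X : Type*) [TopologicalSpace X] : Prop :=
  ∀ A : Set X, IsZeroSet Aᶜ → IsOpen (closure A)

theorem isZeroSet_compl_iUnion_of_isClopen {X : Type*} [TopologicalSpace X] [CompactSpace X]
    [T2Space X] {U : ℕ → Set X} (hU : ∀ n, IsClopen (U n)) : IsZeroSet (⋃ n, U n)ᶜ := by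
  have hclosed : IsClosed (⋃ n, U n)ᶜ := (isOpen_iUnion fun n => (hU n).isOpen).isClosed_compl
  have hGδ : IsGδ (⋃ n, U n)ᶜ := by
    rw [compl_iUnion]
    exact IsGδ.iInter fun n => (hU n).compl.isOpen.isGδ
  obtain ⟨f, hf, -⟩ := exists_continuous_one_zero_of_isCompact_of_isGδ hclosed.isCompact hGδ
    isClosed_empty (disjoint_empty _)
  refine ⟨f - 1, ?_⟩
  rw [hf]
  ext x
  simp [sub_eq_zero]

/-- A sequence of ratios `μ (A n ∩ C) / μ (A n)` tending to zero is stable under unions in `C`. -/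
theorem tendsto_measure_inter_union_div {K : Type*} [MeasurableSpace K] {μ : Measure K}
    [IsFiniteMeasure μ] {A : ℕ → Set K} {S T : Set K}
    (hS : Tendsto (fun n => (μ (A n ∩ S)).toReal / (μ (A n)).toReal) atTop (𝓝 0))
    (hT : Tendsto (fun n => (μ (A n ∩ T)).toReal / (μ (A n)).toReal) atTop (𝓝 0)) :
    Tendsto (fun n => (μ (A n ∩ (S ∪ T))).toReal / (μ (A n)).toReal) atTop (𝓝 0) := by
  refine squeeze_zero (fun n => by positivity) (fun n => ?_) (by simpa using hS.add hT)
  rw [← add_div, inter_union_distrib_left]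
  gcongr
  exact measureReal_union_le _ _

/-- If an increasing sequence `B` of clopen sets is cut off along `φ`, then the closure of the
union of the remaining pieces meets each `A j` inside a single `B m`, with `m` large when `j` is. -/
theorem exists_inter_closure_iUnion_diff_subset {X : Type*} [TopologicalSpace X]
    {A B : ℕ → Set X} (hA : ∀ n, IsClopen (A n)) (hB : ∀ n, IsClosed (B n)) (hmono : Monotone B)
    {φ : ℕ → ℕ} (hφ : StrictMono φ) {N j : ℕ} (hj : φ N < j) :
    ∃ m, N ≤ m ∧ φ m < j ∧ A j ∩ closure (⋃ n, B n \ ⋃ i ≤ φ n, A i) ⊆ A j ∩ B m := by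
  have le_j {n : ℕ} (hn : φ n < j) : n ≤ j := (hφ.id_le n).trans hn.le
  refine ⟨Nat.findGreatest (fun n => φ n < j) j, Nat.le_findGreatest (le_j hj) hj,
    Nat.findGreatest_spec (P := fun n => φ n < j) (le_j hj) hj, ?_⟩
  refine (hA j).isOpen.inter_closure.trans
    (closure_minimal ?_ ((hA j).isClosed.inter (hB _)))
  rintro x ⟨hxj, hx⟩
  obtain ⟨n, hxn, hxA⟩ := mem_iUnion.1 hx
  have hn : φ n < j := by
    by_contra! h
    exact hxA (mem_iUnion₂_of_mem h hxj)
  exact ⟨hxj, hmono (Nat.le_findGreatest (le_j hn) hn) hxn⟩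

/-- Lemma 5.2: for a basically disconnected compact Hausdorff space `K`, a Radon probability
measure `μ` and pairwise disjoint clopen sets `A n` of positive measure, the family `Z` of
clopen sets `C` with `μ(Aₙ ∩ C)/μ(Aₙ) → 0` has the pseudo-union property. -/
theorem stmt_6 {K : Type*} [TopologicalSpace K] [MeasurableSpace K] [BorelSpace K]
    [CompactSpace K] [T2Space K] (hbd : BasicallyDisconnected K)
    (μ : Measure K) [IsProbabilityMeasure μ] [μ.Regular]
    (A : ℕ → Set K) (hclopen : ∀ n, IsClopen (A n))
    (hdisj : ∀ n m, n ≠ m → Disjoint (A n) (A m))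
    (hpos : ∀ n, 0 < μ (A n))
    (Z : Set (Set K))
    (hZ : Z = {C : Set K | IsClopen C ∧
      Tendsto (fun n => (μ (A n ∩ C)).toReal / (μ (A n)).toReal) atTop (𝓝 0)}) :
    ∀ C : ℕ → Set K, (∀ n, C n ∈ Z) →
      ∃ D ∈ Z, ∀ n : ℕ, ∃ m : ℕ, C n \ D ⊆ ⋃ j ≤ m, A j := by
  subst hZ
  intro C hC
  let B : ℕ → Set K := accumulate C
  have hBmono : Monotone B := monotone_accumulate
  have hB (n : ℕ) : IsClopen (B n) ∧
      Tendsto (fun j => (μ (A j ∩ B n)).toReal / (μ (A j)).toReal) atTop (𝓝 0) := by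
    induction n with
    | zero => simpa [B, accumulate_zero_nat] using hC 0
    | succ n ih =>
      simp only [B, accumulate_succ]
      exact ⟨ih.1.union (hC _).1, tendsto_measure_inter_union_div ih.2 (hC _).2⟩
  obtain ⟨φ, hφ, hφB⟩ := extraction_forall_of_eventually fun n : ℕ =>
    eventually_forall_ge_atTop.2 ((hB n).2.eventually_lt_const (Nat.one_div_pos_of_nat (n := n)))
  let D := closure (⋃ n, B n \ ⋃ i ≤ φ n, A i)
  have hpiece (n : ℕ) : IsClopen (B n \ ⋃ i ≤ φ n, A i) :=
    (hB n).1.diff ((finite_Iic (φ n)).isClopen_biUnion fun i _ => hclopen i)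
  refine ⟨D, ⟨⟨isClosed_closure, hbd _ (isZeroSet_compl_iUnion_of_isClopen hpiece)⟩, ?_⟩,
    fun n => ⟨φ n, ?_⟩⟩
  · refine tendsto_order.2 ⟨fun a ha => .of_forall fun j => ha.trans_le (by positivity),
      fun ε hε => ?_⟩
    obtain ⟨N, hN⟩ := exists_nat_one_div_lt hε
    filter_upwards [eventually_gt_atTop (φ N)] with j hj
    obtain ⟨m, hNm, hmj, hsub⟩ := exists_inter_closure_iUnion_diff_subset hclopen
      (fun n => (hB n).1.isClosed) hBmono hφ hj
    calc (μ (A j ∩ D)).toReal / (μ (A j)).toReal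
        ≤ (μ (A j ∩ B m)).toReal / (μ (A j)).toReal := by
          exact div_le_div_of_nonneg_right (measureReal_mono (μ := μ) hsub) (by positivity)
      _ < 1 / ((m : ℝ) + 1) := hφB m j hmj.le
      _ ≤ 1 / ((N : ℝ) + 1) := Nat.one_div_le_one_div hNm
      _ < ε := hN
  · rintro x ⟨hxC, hxD⟩
    by_contra hx
    exact hxD (subset_closure (mem_iUnion.2 ⟨n, subset_accumulate hxC, hx⟩))
end
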